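/- For the octahedron graph (Whitney complex G), the connection graph G' has Euler characteristic 0, which differs from χ(G) = 2; in particular χ(G') ≠ χ(G) in general. -/

import Mathlib

open Finset

/-- Euler characteristic `χ(G) = ∑_x (-1)^{dim x}` with `dim x = card x - 1`. -/
def eulerChar {V : Type*} [DecidableEq V] (G : Finset (Finset V)) : ℚ :=
  ∑ x ∈ G, (-1 : ℚ) ^ (x.card - 1)

/-- The Euler characteristic of the clique complex of the connection graph on the
collection `S` of faces: two faces are adjacent iff they intersect, so cliques are
the nonempty pairwise-intersecting sub-collections. -/
def interChi {V : Type*} [DecidableEq V] (S : Finset (Finset V)) : ℚ :=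
  ∑ c ∈ S.powerset.filter
      (fun c => c.Nonempty ∧ ∀ y ∈ c, ∀ z ∈ c, (y ∩ z).Nonempty),
    (-1 : ℚ) ^ (c.card - 1)

/-- The Whitney (clique) complex of the octahedron graph `K_{2,2,2}` on vertices
`Fin 6`, where `a ∼ b` iff `a ≠ b` and `a % 3 ≠ b % 3` (antipodal pairs
`{0,3}, {1,4}, {2,5}` are non-adjacent). -/
def octG : Finset (Finset (Fin 6)) :=
  Finset.univ.filter (fun s : Finset (Fin 6) =>
    s.Nonempty ∧ ∀ a ∈ s, ∀ b ∈ s, a ≠ b → (a : ℕ) % 3 ≠ (b : ℕ) % 3)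

/-- Pairwise intersecting. -/
def PInt (c : Finset (Finset (Fin 6))) : Prop := ∀ y ∈ c, ∀ z ∈ c, (y ∩ z).Nonempty

instance (c : Finset (Finset (Fin 6))) : Decidable (PInt c) := by
  unfold PInt; infer_instance

/-- Signed count of all (possibly empty) cliques. -/
def cliqueSum (S : Finset (Finset (Fin 6))) : ℤ :=
  ∑ c ∈ S.powerset, if PInt c then (-1 : ℤ) ^ c.card else 0

theorem cliqueSum_insert (v : Finset (Fin 6)) (S : Finset (Finset (Fin 6)))
    (hv : v ∉ S) (hne : v.Nonempty) :
    cliqueSum (insert v S) =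
      cliqueSum S - cliqueSum (S.filter (fun x => (v ∩ x).Nonempty)) := by
  unfold cliqueSum
  rw [Finset.sum_powerset_insert hv, sub_eq_add_neg, ← Finset.sum_neg_distrib]
  congr 1
  symm
  have hsub : (S.filter (fun x => (v ∩ x).Nonempty)).powerset ⊆ S.powerset :=
    Finset.powerset_mono.2 (Finset.filter_subset _ _)
  rw [← Finset.sum_subset hsub (f := fun c =>
    if PInt (insert v c) then (-1 : ℤ) ^ (insert v c).card else 0)]
  · apply Finset.sum_congr rfl
    intro c hc
    rw [Finset.mem_powerset] at hc
    have hvc : v ∉ c := fun h => hv (Finset.mem_filter.1 (hc h)).1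
    have hiff : PInt (insert v c) ↔ PInt c := by
      constructor
      · intro h y hy z hz
        exact h y (Finset.mem_insert_of_mem hy) z (Finset.mem_insert_of_mem hz)
      · intro h y hy z hz
        rcases Finset.mem_insert.1 hy with rfl | hyc
        · rcases Finset.mem_insert.1 hz with rfl | hz
          · simpa using hne
          · exact (Finset.mem_filter.1 (hc hz)).2
        · rcases Finset.mem_insert.1 hz with rfl | hz
          · rw [Finset.inter_comm]
            exact (Finset.mem_filter.1 (hc hyc)).2
          · exact h y hyc z hz
    simp only [hiff, Finset.card_insert_of_notMem hvc, pow_succ]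
    split_ifs <;> simp
  · intro c hc hn
    rw [if_neg]
    intro h
    apply hn
    rw [Finset.mem_powerset] at hc ⊢
    intro x hx
    exact Finset.mem_filter.2 ⟨hc hx,
      h v (Finset.mem_insert_self _ _) x (Finset.mem_insert_of_mem hx)⟩

/-- Deletion recursion on bit masks (with fuel). -/
def rec_count : ℕ → List ℕ → ℤ
  | 0, _ => 1
  | _ + 1, [] => 1
  | n + 1, v :: r =>
      rec_count n r - rec_count n (r.filter (fun x => !(Nat.beq (Nat.land v x) 0)))

/-- The face with a given bit mask. -/
def enc (m : ℕ) : Finset (Fin 6) := Finset.univ.filter (fun i => m.testBit i = true)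

/-- Masks of the faces of the octahedron. -/
def masks : List ℕ :=
  (List.range 64).filter (fun m => m != 0 && Nat.land m (m >>> 3) % 8 == 0)

theorem enc_inter : ∀ a ∈ masks, ∀ b ∈ masks,
    ((enc a ∩ enc b).Nonempty ↔ (!(Nat.beq (Nat.land a b) 0)) = true) := by
  decide +kernel

theorem enc_inj : ∀ a ∈ masks, ∀ b ∈ masks, enc a = enc b → a = b := by
  decide +kernel

theorem enc_nonempty : ∀ a ∈ masks, (enc a).Nonempty := by
  decide +kernel

theorem octG_eq : octG = (masks.map enc).toFinset := by
  decide +kernel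

theorem cliqueSum_rec : ∀ (n : ℕ) (l : List ℕ), l.length ≤ n → l.Nodup → (∀ a ∈ l, a ∈ masks) →
    cliqueSum (l.map enc).toFinset = rec_count n l := by
  have h0 : cliqueSum ∅ = 1 := by decide
  intro n
  induction n with
  | zero =>
    intro l hl _ _
    have : l = [] := List.length_eq_zero_iff.1 (by omega)
    subst this
    simpa [rec_count] using h0
  | succ n ih =>
    intro l hl hd hm
    cases l with
    | nil => simpa [rec_count] using h0
    | cons v r =>
      have hvm : v ∈ masks := hm v (by simp)
      have hrm : ∀ a ∈ r, a ∈ masks := fun a ha => hm a (by simp [ha])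
      rw [List.nodup_cons] at hd
      simp only [List.length_cons] at hl
      rw [List.map_cons, List.toFinset_cons, cliqueSum_insert _ _ _ (enc_nonempty v hvm)]
      · rw [rec_count, ih r (by omega) hd.2 hrm, ← ih (r.filter _)
          ((List.length_filter_le _ _).trans (by omega)) (hd.2.filter _)
          (fun a ha => hrm a (List.mem_filter.1 ha).1)]
        congr 2
        ext1 x
        simp only [Finset.mem_filter, List.mem_toFinset, List.mem_map, List.mem_filter]
        constructor
        · rintro ⟨⟨a, ha, rfl⟩, h⟩
          exact ⟨a, ⟨ha, (enc_inter v hvm a (hrm a ha)).1 h⟩, rfl⟩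
        · rintro ⟨a, ⟨ha, h⟩, rfl⟩
          exact ⟨⟨a, ha, rfl⟩, (enc_inter v hvm a (hrm a ha)).2 h⟩
      · intro h
        obtain ⟨a, ha, hav⟩ := List.mem_map.1 (List.mem_toFinset.1 h)
        exact hd.1 (enc_inj a (hrm a ha) v hvm hav ▸ ha)

theorem count_val : rec_count 26 masks = 1 := by
  decide +kernel

theorem cliqueSum_octG : cliqueSum octG = 1 := by
  rw [octG_eq, cliqueSum_rec 26 masks (by decide +kernel) (by decide +kernel) (fun _ h => h),
    count_val]

theorem interChi_eq (S : Finset (Finset (Fin 6))) : interChi S = 1 - (cliqueSum S : ℚ) := by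
  unfold interChi cliqueSum
  rw [← Finset.add_sum_erase _ _ (Finset.empty_mem_powerset S), Finset.sum_filter,
    ← Finset.add_sum_erase _ _ (Finset.empty_mem_powerset S)]
  have h : PInt ∅ := by intro y hy; simp at hy
  simp only [h, if_true, Finset.card_empty, pow_zero, Finset.not_nonempty_empty, false_and,
    if_false, zero_add]
  push_cast
  rw [sub_add_cancel_left, ← Finset.sum_neg_distrib]
  apply Finset.sum_congr rfl
  intro c hc
  have hc0 : c.Nonempty := Finset.nonempty_iff_ne_empty.2 (Finset.mem_erase.1 hc).1
  have hp := hc0.card_pos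
  obtain ⟨k, hk⟩ : ∃ k, c.card = k + 1 := ⟨c.card - 1, by omega⟩
  simp only [hc0, true_and, hk, PInt, pow_succ, Nat.add_sub_cancel]
  split_ifs <;> simp

theorem eulerChar_octG : eulerChar octG = 2 := by
  have h : ∑ x ∈ octG, (-1 : ℤ) ^ (x.card - 1) = 2 := by decide +kernel
  unfold eulerChar
  exact_mod_cast h

/-- for the octahedron complex `G`, the connection graph `G'` has
Euler characteristic `0`, while `χ(G) = 2`; in particular `χ(G') ≠ χ(G)`. -/
theorem octahedron_connection_chi :
    interChi octG = 0 ∧ eulerChar octG = 2 ∧ interChi octG ≠ eulerChar octG := by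
  have h : interChi octG = 0 := by
    rw [interChi_eq, cliqueSum_octG]; norm_num
  refine ⟨h, eulerChar_octG, ?_⟩
  rw [h, eulerChar_octG]; norm_num
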